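/- Let A, B ⊆ ℝ be Lebesgue measurable sets with positive, finite Lebesgue measures and let 0 ≤ τ < max(|A|,|B|). If |S_{A,B}(τ)| ≥ |A| + |B|, then ∫_τ^∞ |S_{A,B}(t)| dt ≤ |A|·|B| − τ·|S_{A,B}(τ)|. -/

import Mathlib

open MeasureTheory Set Pointwise

/-- Lebesgue measure of a set of reals, as a real number. -/
noncomputable def lm (S : Set ℝ) : ℝ := (MeasureTheory.volume S).toReal

/-- Convolution of indicator functions: `(1_A ∗ 1_B)(x) = ∫ 1_A(y) 1_B(x−y) dy`. -/
noncomputable def cv (A B : Set ℝ) (x : ℝ) : ℝ :=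
  ∫ y, A.indicator (1 : ℝ → ℝ) y * B.indicator (1 : ℝ → ℝ) (x - y)

/-- The pairing `⟨1_A ∗ 1_B, 1_C⟩ = ∫ (1_A ∗ 1_B) · 1_C`. -/
noncomputable def pr (A B C : Set ℝ) : ℝ := ∫ x, cv A B x * C.indicator (1 : ℝ → ℝ) x

/-- The symmetric rearrangement `S⋆`: the open interval centered at 0 with `|S⋆| = |S|`. -/
noncomputable def sstar (S : Set ℝ) : Set ℝ := Set.Ioo (-(lm S / 2)) (lm S / 2)

/-- The Riesz–Sobolev deficit `D(A,B,C) = ⟨1_{A⋆}∗1_{B⋆},1_{C⋆}⟩ − ⟨1_A∗1_B,1_C⟩`. -/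
noncomputable def rsD (A B C : Set ℝ) : ℝ := pr (sstar A) (sstar B) (sstar C) - pr A B C

/-- The superlevel set `S_{A,B}(t) = {x : (1_A ∗ 1_B)(x) > t}`. -/
def slev (A B : Set ℝ) (t : ℝ) : Set ℝ := {x | cv A B x > t}

/-- The KPRGT deficit `D′(A,B,τ) = (|A|−τ)(|B|−τ) − ∫_τ^∞ |S_{A,B}(t)| dt`. -/
noncomputable def kD (A B : Set ℝ) (τ : ℝ) : ℝ :=
  (lm A - τ) * (lm B - τ) - ∫ t in Set.Ioi τ, lm (slev A B t)

/-- `η`-strict admissibility of the ordered triple `(A,B,C)`: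
`|X| + |Y| ≥ |Z| + η·max(|A|,|B|,|C|)` for every permutation `(X,Y,Z)` of `(A,B,C)`. -/
def adm (η : ℝ) (A B C : Set ℝ) : Prop :=
  lm A + lm B ≥ lm C + η * max (lm A) (max (lm B) (lm C)) ∧
  lm A + lm C ≥ lm B + η * max (lm A) (max (lm B) (lm C)) ∧
  lm B + lm C ≥ lm A + η * max (lm A) (max (lm B) (lm C))

/-- Convolution of indicator functions as Mathlib's convolution. -/
theorem cv_eq_convolution (A B : Set ℝ) :
    cv A B = MeasureTheory.convolution (A.indicator (1 : ℝ → ℝ)) (B.indicator (1 : ℝ → ℝ))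
      (ContinuousLinearMap.mul ℝ ℝ) volume := rfl

theorem integrable_indicator_one_of_finite {A : Set ℝ} (hA : MeasurableSet A)
    (hAf : volume A ≠ ⊤) : Integrable (A.indicator (1 : ℝ → ℝ)) :=
  (integrable_indicator_iff hA).2 (integrableOn_const hAf)

theorem integrable_cv {A B : Set ℝ} (hA : MeasurableSet A) (hB : MeasurableSet B)
    (hAf : volume A ≠ ⊤) (hBf : volume B ≠ ⊤) : Integrable (cv A B) := by
  rw [cv_eq_convolution]
  exact (integrable_indicator_one_of_finite hA hAf).integrable_convolution _
    (integrable_indicator_one_of_finite hB hBf)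

theorem integral_cv {A B : Set ℝ} (hA : MeasurableSet A) (hB : MeasurableSet B)
    (hAf : volume A ≠ ⊤) (hBf : volume B ≠ ⊤) : ∫ x, cv A B x = lm A * lm B := by
  rw [cv_eq_convolution, integral_convolution _ (integrable_indicator_one_of_finite hA hAf)
    (integrable_indicator_one_of_finite hB hBf), integral_indicator_one hA,
    integral_indicator_one hB]
  rfl

theorem cv_nonneg (A B : Set ℝ) (x : ℝ) : 0 ≤ cv A B x :=
  integral_nonneg fun _ => mul_nonneg (indicator_nonneg (fun _ _ => zero_le_one) _)
    (indicator_nonneg (fun _ _ => zero_le_one) _)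

/-- Layer-cake formula for the part of the convolution above height `τ`. -/
theorem integral_lm_slev {A B : Set ℝ} {τ : ℝ}
    (hg : Integrable fun x => max (cv A B x - τ) 0) :
    ∫ t in Set.Ioi τ, lm (slev A B t) = ∫ x, max (cv A B x - τ) 0 := by
  rw [hg.integral_eq_integral_meas_lt (ae_of_all _ fun x => le_max_right _ _)]
  have h := (measurePreserving_add_right volume τ).setIntegral_preimage_emb
    (measurableEmbedding_addRight τ) (fun t => lm (slev A B t)) (Set.Ioi τ)
  rw [← h, show (fun x : ℝ => x + τ) ⁻¹' Set.Ioi τ = Set.Ioi 0 by ext; simp]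
  refine setIntegral_congr_fun measurableSet_Ioi fun t ht => ?_
  have ht : 0 < t := ht
  have hset : slev A B (t + τ) = {x | t < max (cv A B x - τ) 0} := by
    ext x
    simp only [slev, mem_ofPred_eq, gt_iff_lt, lt_max_iff, ht.not_gt, or_false, lt_sub_iff_add_lt]
  simp only [hset]
  rfl

/-- A version of the KPRGT inequality outside the usual range. -/
theorem kprgt_outside_range (A B : Set ℝ)
    (hA : MeasurableSet A) (hB : MeasurableSet B)
    (hA0 : 0 < volume A) (hAf : volume A ≠ ⊤)
    (hB0 : 0 < volume B) (hBf : volume B ≠ ⊤)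
    (τ : ℝ) (hτ0 : 0 ≤ τ) (hτ : τ < max (lm A) (lm B))
    (hS : lm (slev A B τ) ≥ lm A + lm B) :
    (∫ t in Set.Ioi τ, lm (slev A B t)) ≤ lm A * lm B - τ * lm (slev A B τ) := by
  have hf := integrable_cv hA hB hAf hBf
  have hSf : volume (slev A B τ) ≠ ⊤ := by
    intro h
    have hpA : 0 < lm A := ENNReal.toReal_pos hA0.ne' hAf
    have hpB : 0 < lm B := ENNReal.toReal_pos hB0.ne' hBf
    simp only [lm, h, ENNReal.toReal_top] at hS hpA hpB
    linarith
  have hSm : NullMeasurableSet (slev A B τ) :=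
    nullMeasurableSet_lt aemeasurable_const hf.aemeasurable
  have hg : Integrable fun x => max (cv A B x - τ) 0 := by
    refine hf.mono' ((hf.aestronglyMeasurable.sub aestronglyMeasurable_const).sup
      aestronglyMeasurable_const) (ae_of_all _ fun x => ?_)
    rw [Real.norm_of_nonneg (le_max_right _ _)]
    exact max_le (by linarith) (cv_nonneg A B x)
  have hi : Integrable ((slev A B τ).indicator fun _ => τ) :=
    (integrableOn_const hSf).integrable_indicator₀ hSm
  have hint : ∫ x, (slev A B τ).indicator (fun _ => τ) x = τ * lm (slev A B τ) := by
    rw [integral_indicator₀ hSm, setIntegral_const, smul_eq_mul, mul_comm]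
    rfl
  rw [integral_lm_slev hg, ← integral_cv hA hB hAf hBf, ← hint, ← integral_sub hf hi]
  refine integral_mono hg (hf.sub hi) fun x => ?_
  by_cases hx : x ∈ slev A B τ
  · have hx' : τ < cv A B x := hx
    simp [hx, hx'.le]
  · have hx' : cv A B x ≤ τ := not_lt.1 hx
    simp [hx, hx', cv_nonneg A B x]
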